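/- arXiv:2302.07352 — 3 statements merged into one kernel-verified Lean document; each statement's English description precedes it below -/
import Mathlib

section
/- Let Z1 = (c1, G1) and Z2 = (c2, G2) be zonotopes in ℝⁿ, and let Z_{2,buf} = (c2, [G1 G2]) be the buffered zonotope whose generator matrix is the concatenation of G1 and G2. Then Z1 ∩ Z2 ≠ ∅ if and only if c1 ∈ Z_{2,buf}. -/
/-- A zonotope in `ℝⁿ` with center `c` and generator (column) vectors `g i`:
`Z = { c + Σᵢ βᵢ gᵢ : ‖β‖_∞ ≤ 1 }`. -/
def zonotope {n : ℕ} {ι : Type*} [Fintype ι]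
    (c : EuclideanSpace ℝ (Fin n)) (g : ι → EuclideanSpace ℝ (Fin n)) :
    Set (EuclideanSpace ℝ (Fin n)) :=
  {z | ∃ β : ι → ℝ, (∀ i, |β i| ≤ 1) ∧ z = c + ∑ i, β i • g i}

/-- Two zonotopes intersect iff the center of the first lies in the buffered
zonotope `(c₂, [G₁ G₂])`. -/
theorem zonotope_inter_nonempty_iff_center_mem_buffered
    {n m₁ m₂ : ℕ} (c₁ c₂ : EuclideanSpace ℝ (Fin n))
    (g₁ : Fin m₁ → EuclideanSpace ℝ (Fin n))
    (g₂ : Fin m₂ → EuclideanSpace ℝ (Fin n)) :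
    zonotope c₁ g₁ ∩ zonotope c₂ g₂ ≠ ∅ ↔
      c₁ ∈ zonotope c₂ (Sum.elim g₁ g₂) := by
  rw [← Set.nonempty_iff_ne_empty]
  constructor
  · rintro ⟨z, ⟨β, hβ, hz⟩, γ, hγ, hz'⟩
    refine ⟨Sum.elim (-β) γ, ?_, ?_⟩
    · rintro (i | j)
      · simpa using hβ i
      · simpa using hγ j
    · rw [eq_sub_of_add_eq (hz.symm.trans hz')]
      simp only [Fintype.sum_sum_type, Sum.elim_inl, Sum.elim_inr, Pi.neg_apply, neg_smul,
        Finset.sum_neg_distrib]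
      abel
  · rintro ⟨β, hβ, hc⟩
    refine ⟨c₂ + ∑ j, β (Sum.inr j) • g₂ j, ⟨fun i => -β (Sum.inl i), ?_, ?_⟩,
      fun j => β (Sum.inr j), fun j => hβ _, rfl⟩
    · intro i
      simpa using hβ (Sum.inl i)
    · rw [hc]
      simp only [Fintype.sum_sum_type, Sum.elim_inl, Sum.elim_inr, neg_smul,
        Finset.sum_neg_distrib]
      abel
end

section
/- Let Z1 = (c1, G1) and Z2 = (c2, G2) be zonotopes in ℝⁿ with Z1 ∩ Z2 = ∅, and let Z_{2,buf} = (c2, [G1 G2]) be the buffered zonotope. Then the distance between the sets Z1 and Z2 equals the distance from the point c1 to the set Z_{2,buf}, i.e., inf { ‖z1 − z2‖ : z1 ∈ Z1, z2 ∈ Z2 } = inf { ‖c1 − z‖ : z ∈ Z_{2,buf} }. -/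
/-- Distance from a point `x` to a set `S`: `inf { ‖x − y‖ : y ∈ S }`. -/
noncomputable def distPtSet {n : ℕ} (x : EuclideanSpace ℝ (Fin n))
    (S : Set (EuclideanSpace ℝ (Fin n))) : ℝ :=
  sInf ((fun y => ‖x - y‖) '' S)

/-- Distance between sets `A` and `B`: `inf { ‖a − b‖ : a ∈ A, b ∈ B }`. -/
noncomputable def distSet {n : ℕ} (A B : Set (EuclideanSpace ℝ (Fin n))) : ℝ :=
  sInf ((fun p : EuclideanSpace ℝ (Fin n) × EuclideanSpace ℝ (Fin n) => ‖p.1 - p.2‖)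
    '' (A ×ˢ B))

/-- Differences of points of two zonotopes are the differences of the first center and points of
the buffered zonotope. -/
theorem exists_mem_zonotope_sub_eq_iff {n : ℕ} {ι κ : Type*} [Fintype ι] [Fintype κ]
    (c₁ c₂ v : EuclideanSpace ℝ (Fin n)) (g₁ : ι → EuclideanSpace ℝ (Fin n))
    (g₂ : κ → EuclideanSpace ℝ (Fin n)) :
    (∃ a ∈ zonotope c₁ g₁, ∃ b ∈ zonotope c₂ g₂, a - b = v) ↔
      ∃ z ∈ zonotope c₂ (Sum.elim g₁ g₂), c₁ - z = v := by
  constructor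
  · rintro ⟨_, ⟨β, hβ, rfl⟩, _, ⟨γ, hγ, rfl⟩, rfl⟩
    refine ⟨_, ⟨Sum.elim (-β) γ, ?_, rfl⟩, ?_⟩
    · rintro (i | i)
      · simpa using hβ i
      · exact hγ i
    · simp only [Fintype.sum_sum_type, Sum.elim_inl, Sum.elim_inr, Pi.neg_apply, neg_smul,
        Finset.sum_neg_distrib]
      abel
  · rintro ⟨_, ⟨β, hβ, rfl⟩, rfl⟩
    refine ⟨_, ⟨fun i => -β (Sum.inl i), fun i => ?_, rfl⟩,
      _, ⟨fun i => β (Sum.inr i), fun i => hβ _, rfl⟩, ?_⟩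
    · simpa using hβ (Sum.inl i)
    · simp only [Fintype.sum_sum_type, Sum.elim_inl, Sum.elim_inr, neg_smul,
        Finset.sum_neg_distrib]
      abel

/-- For disjoint zonotopes `Z₁ = (c₁,G₁)` and `Z₂ = (c₂,G₂)`, the distance between
the sets `Z₁` and `Z₂` equals the distance from the point `c₁` to the buffered
zonotope `Z₂ᵇᵘᶠ = (c₂, [G₁ G₂])`. -/
theorem distSet_zonotope_eq_distPt_buffered
    {n m₁ m₂ : ℕ} (c₁ c₂ : EuclideanSpace ℝ (Fin n))
    (g₁ : Fin m₁ → EuclideanSpace ℝ (Fin n))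
    (g₂ : Fin m₂ → EuclideanSpace ℝ (Fin n))
    (hdisj : zonotope c₁ g₁ ∩ zonotope c₂ g₂ = ∅) :
    distSet (zonotope c₁ g₁) (zonotope c₂ g₂) =
      distPtSet c₁ (zonotope c₂ (Sum.elim g₁ g₂)) := by
  unfold distSet distPtSet
  congr 1
  ext r
  constructor
  · rintro ⟨⟨a, b⟩, ⟨ha, hb⟩, rfl⟩
    obtain ⟨z, hz, h⟩ :=
      (exists_mem_zonotope_sub_eq_iff c₁ c₂ (a - b) g₁ g₂).1 ⟨a, ha, b, hb, rfl⟩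
    exact ⟨z, hz, congrArg norm h⟩
  · rintro ⟨z, hz, rfl⟩
    obtain ⟨a, ha, b, hb, h⟩ :=
      (exists_mem_zonotope_sub_eq_iff c₁ c₂ (c₁ - z) g₁ g₂).2 ⟨z, hz, rfl⟩
    exact ⟨(a, b), ⟨ha, hb⟩, congrArg norm h⟩
end

section
/- Let O = (c_O, G_O) be an obstacle zonotope in ℝⁿ and let Z_1, …, Z_N be zonotopes in ℝⁿ with Z_i = (c_i, G_i). For each i let Z_i^{buf} = (c_i, [G_O G_i]) be the buffered zonotope, and let P be the convex hull of ∪_{i=1}^{N} Z_i^{buf}. If O ∩ Z_i = ∅ for every i = 1, …, N, then the distance from the point c_O to P is a lower bound on the set distance between O and each Z_i: d(c_O, P) ≤ min_{i=1,…,N} d(O, Z_i). -/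
theorem center_mem_zonotope {n : ℕ} {ι : Type*} [Fintype ι]
    (c : EuclideanSpace ℝ (Fin n)) (g : ι → EuclideanSpace ℝ (Fin n)) :
    c ∈ zonotope c g :=
  ⟨0, by simp, by simp⟩

/-- The translate of a point of `(c, G)` by the negated offset of a point of `(c₀, G₀)` from its
center lies in the buffered zonotope `(c, [G₀ G])`. -/
theorem sub_offset_mem_zonotope_sumElim {n : ℕ} {ι κ : Type*} [Fintype ι] [Fintype κ]
    {c₀ c a b : EuclideanSpace ℝ (Fin n)} {g₀ : ι → EuclideanSpace ℝ (Fin n)}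
    {g : κ → EuclideanSpace ℝ (Fin n)}
    (ha : a ∈ zonotope c₀ g₀) (hb : b ∈ zonotope c g) :
    b - (a - c₀) ∈ zonotope c (Sum.elim g₀ g) := by
  obtain ⟨β, hβ, rfl⟩ := ha
  obtain ⟨γ, hγ, rfl⟩ := hb
  refine ⟨Sum.elim (-β) γ, ?_, ?_⟩
  · rintro (i | i)
    · simpa using hβ i
    · simpa using hγ i
  · simp only [Fintype.sum_sum_type, Sum.elim_inl, Sum.elim_inr, Pi.neg_apply, neg_smul,
      Finset.sum_neg_distrib]
    abel

theorem distPtSet_le_norm_sub {n : ℕ} {S : Set (EuclideanSpace ℝ (Fin n))}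
    {x y : EuclideanSpace ℝ (Fin n)} (hy : y ∈ S) : distPtSet x S ≤ ‖x - y‖ :=
  csInf_le ⟨0, by rintro _ ⟨z, -, rfl⟩; exact norm_nonneg _⟩ ⟨y, hy, rfl⟩

/-- Let `O = (c_O, G_O)` be an obstacle zonotope and `Z i = (cᵢ, Gᵢ)` zonotopes, each
disjoint from `O`. With `Zᵢᵇᵘᶠ = (cᵢ, [G_O Gᵢ])` and `P` the convex hull of the union
of the buffered zonotopes, the distance from `c_O` to `P` is a lower bound on the
minimal set distance between `O` and the `Z i`. -/
theorem distPt_convexHull_buffered_le_min_distSet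
    {n N mO : ℕ} (hN : 0 < N)
    (cO : EuclideanSpace ℝ (Fin n)) (gO : Fin mO → EuclideanSpace ℝ (Fin n))
    (m : Fin N → ℕ) (c : Fin N → EuclideanSpace ℝ (Fin n))
    (g : ∀ i : Fin N, Fin (m i) → EuclideanSpace ℝ (Fin n))
    (hdisj : ∀ i, zonotope cO gO ∩ zonotope (c i) (g i) = ∅) :
    distPtSet cO (convexHull ℝ (⋃ i, zonotope (c i) (Sum.elim gO (g i)))) ≤
      Finset.univ.inf' ⟨⟨0, hN⟩, Finset.mem_univ _⟩
        (fun i : Fin N => distSet (zonotope cO gO) (zonotope (c i) (g i))) := by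
  refine Finset.le_inf' _ _ fun i _ => le_csInf ?_ ?_
  · exact ⟨_, (cO, c i), ⟨center_mem_zonotope _ _, center_mem_zonotope _ _⟩, rfl⟩
  · rintro _ ⟨⟨a, b⟩, ⟨ha, hb⟩, rfl⟩
    have hy := subset_convexHull ℝ _
      (Set.mem_iUnion_of_mem (s := fun i => zonotope (c i) (Sum.elim gO (g i))) i
        (sub_offset_mem_zonotope_sumElim ha hb))
    refine (distPtSet_le_norm_sub hy).trans_eq ?_
    congr 1
    dsimp only
    abel
end
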